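/- The operator Z satisfies the exchange relations. For 1 ≤ i ≤ n−1, writing τ_i Z for Z with the variables x_i and x_{i+1} interchanged: (τ_i Z) · Ř_{n+i}(x_{i+1}/x_i) = Ř_i(x_{i+1}/x_i) · Z as operators on M. For 1 ≤ j ≤ n−1, writing τ'_j Z for Z with the variables y_j and y_{j+1} interchanged: Ř_{n+j}(y_j/y_{j+1}) · (τ'_j Z) = Z · Ř_j(y_j/y_{j+1}) as operators on M. -/

import Mathlib

open Finset

noncomputable section

/-- The ambient field: fraction field of polynomials over `ℚ` in countably many
indeterminates; `qq`, `tt` and the `xx i`, `yy i` below are algebraically independent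
indeterminates, so identities among them are identities of rational functions
in `q`, `t` and the `x i` (and `y i`) over `ℚ`. -/
abbrev F : Type := FractionRing (MvPolynomial ℕ ℚ)

def gen (i : ℕ) : F := algebraMap (MvPolynomial ℕ ℚ) F (MvPolynomial.X i)

/-- the indeterminate `q` -/
def qq : F := gen 0
/-- the indeterminate `t` -/
def tt : F := gen 1
/-- the indeterminate `x_{i+1}` (0-based) -/
def xx (i : ℕ) : F := gen (2 + 2 * i)
/-- the indeterminate `y_{i+1}` (0-based) -/
def yy (i : ℕ) : F := gen (3 + 2 * i)

/-- labelings of the `2n` edge positions by values in `{1,…,n+1}` (0-based). -/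
abbrev Lab (n : ℕ) := Fin (2 * n) → Fin (n + 1)

abbrev Mat (n : ℕ) := Matrix (Lab n) (Lab n) F

/-- the structure constant `c((a,b),(a',b'))` of the generator `T`. -/
def Tcoeff (n : ℕ) (a b a' b' : Fin (n + 1)) : F :=
  if a' = a ∧ b' = b ∧ b < a then tt - 1
  else if a' = b ∧ b' = a ∧ a < b then 1
  else if a' = b ∧ b' = a ∧ b ≤ a then tt
  else 0

/-- the (standard, column-convention) matrix of `T_i` acting at 0-based positions `p, p+1`:
the `(κ, κ')` entry is the coefficient of `e_κ` in `T e_{κ'}`. -/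
def Tmat (n : ℕ) (p : ℕ) : Mat n :=
  Matrix.of fun κ κ' =>
    if h : p + 1 < 2 * n then
      if ∀ j : Fin (2 * n), (j : ℕ) ≠ p → (j : ℕ) ≠ p + 1 → κ j = κ' j then
        Tcoeff n (κ' ⟨p, by omega⟩) (κ' ⟨p + 1, h⟩) (κ ⟨p, by omega⟩) (κ ⟨p + 1, h⟩)
      else 0
    else 0

/-- `Ř_i(u) = (1−t)·Id + (1−u)·T_i` at 0-based position `p`. -/
def Rmat (n : ℕ) (p : ℕ) (u : F) : Mat n := (1 - tt) • (1 : Mat n) + (1 - u) • Tmat n p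

/-- the ordered product `Z = ∏_{j=1}^{n} (Ř_{n+j−1}(xₙ/y_j)·Ř_{n+j−2}(x_{n−1}/y_j)⋯Ř_j(x₁/y_j))`,
columns `j = 1,…,n` multiplied left to right (matrices in the standard convention, so that
an operator product written left to right is the corresponding matrix product). -/
def Zmat (n : ℕ) (x y : ℕ → F) : Mat n :=
  ((List.range n).map fun j =>
    ((List.range n).map fun r => Rmat n (j + (n - 1 - r)) (x (n - 1 - r) / y j)).prod).prod

/-- the labeling `(ω̄(v(1)),…,ω̄(v(2n)))` of `|v⟩` for `v ∈ Sₙ ⊂ S_{2n}`. -/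
def labP (n : ℕ) (v : Equiv.Perm (Fin n)) : Lab n := fun p =>
  if h : (p : ℕ) < n then Fin.castSucc (v ⟨p, h⟩) else Fin.last n

/-- the number of inversions (Coxeter length) of a permutation. -/
def ell {n : ℕ} (v : Equiv.Perm (Fin n)) : ℕ :=
  ((Finset.univ : Finset (Fin n × Fin n)).filter fun p => p.1 < p.2 ∧ v p.2 < v p.1).card

/-- `αₙ = (q/t)^{n(n−1)/2} (1−t)^{−n}`. -/
def alpha (n : ℕ) : F := (qq / tt) ^ (n * (n - 1) / 2) * (1 - tt)⁻¹ ^ n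

/-- the matrix element `F_v = ⟨1| Z |v⟩`. -/
def Fv (n : ℕ) (x y : ℕ → F) (v : Equiv.Perm (Fin n)) : F :=
  Zmat n x y (labP n 1) (labP n v)

lemma gen_ne_zero (i : ℕ) : gen i ≠ 0 := by
  simp [gen]

lemma xx_ne_zero (i : ℕ) : xx i ≠ 0 := gen_ne_zero _

lemma yy_ne_zero (i : ℕ) : yy i ≠ 0 := gen_ne_zero _

section Exchange

variable {R ι A : Type*} [CommRing R] [DecidableEq ι]

lemma comp_swap_comp_swap (κ : ι → A) (p q : ι) :
    (κ ∘ Equiv.swap p q) ∘ Equiv.swap p q = κ := by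
  funext x; simp

variable [LinearOrder A]

/-- The right action of the Hecke generator at positions `p, q` on functions of labelings. -/
def exchange (t : R) (p q : ι) (f : (ι → A) → R) (κ : ι → A) : R :=
  if κ q < κ p then (t - 1) * f κ + t * f (κ ∘ Equiv.swap p q)
  else if κ p < κ q then f (κ ∘ Equiv.swap p q)
  else t * f κ

lemma exchange_exchange_self (t : R) (p q : ι) (f : (ι → A) → R) :
    exchange t p q (exchange t p q f) = (t - 1) • exchange t p q f + t • f := by
  funext κ
  rcases lt_trichotomy (κ p) (κ q) with h | h | h <;>
    simp [exchange, h, h.not_gt, comp_swap_comp_swap]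
  ring

lemma exchange_comm (t : R) {p q r s : ι} (hpr : p ≠ r) (hps : p ≠ s) (hqr : q ≠ r) (hqs : q ≠ s)
    (f : (ι → A) → R) :
    exchange t p q (exchange t r s f) = exchange t r s (exchange t p q f) := by
  funext κ
  have hs : (κ ∘ Equiv.swap p q) ∘ Equiv.swap r s = (κ ∘ Equiv.swap r s) ∘ Equiv.swap p q := by
    funext x
    simp only [Function.comp_apply, Equiv.swap_apply_def]
    split_ifs <;> simp_all
  rcases lt_trichotomy (κ p) (κ q) with h | h | h <;>
    rcases lt_trichotomy (κ r) (κ s) with h' | h' | h' <;>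
    simp [exchange, h, h.not_gt, h', h'.not_gt, hs, Equiv.swap_apply_of_ne_of_ne, hpr, hps, hqr,
      hqs, hpr.symm, hps.symm, hqr.symm, hqs.symm] <;> ring

set_option maxHeartbeats 2000000 in
lemma exchange_braid (t : R) {p q r : ι} (hpq : p ≠ q) (hpr : p ≠ r) (hqr : q ≠ r)
    (f : (ι → A) → R) :
    exchange t p q (exchange t q r (exchange t p q f)) =
      exchange t q r (exchange t p q (exchange t q r f)) := by
  funext κ
  have hs : ((κ ∘ Equiv.swap p q) ∘ Equiv.swap q r) ∘ Equiv.swap p q =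
      ((κ ∘ Equiv.swap q r) ∘ Equiv.swap p q) ∘ Equiv.swap q r := by
    funext x
    simp only [Function.comp_apply, Equiv.swap_apply_def]
    split_ifs <;> simp_all
  have e₁ : Equiv.swap p q r = r := Equiv.swap_apply_of_ne_of_ne hpr.symm hqr.symm
  have e₂ : Equiv.swap q r p = p := Equiv.swap_apply_of_ne_of_ne hpq hpr
  rcases lt_trichotomy (κ p) (κ q) with h | h | h <;>
    rcases lt_trichotomy (κ q) (κ r) with h' | h' | h' <;>
    rcases lt_trichotomy (κ p) (κ r) with h'' | h'' | h'' <;>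
    first
    | (exfalso; order)
    | (simp [exchange, h, h.not_gt, h', h'.not_gt, h'', h''.not_gt, hs, e₁, e₂,
        comp_swap_comp_swap]
       try ring)

end Exchange

lemma Tcoeff_eq (n : ℕ) (a b a' b' : Fin (n + 1)) :
    Tcoeff n a b a' b' =
      if b < a then
        (tt - 1) * (if a' = a ∧ b' = b then 1 else 0) + tt * if a' = b ∧ b' = a then 1 else 0
      else if a < b then if a' = b ∧ b' = a then 1 else 0
      else tt * if a' = a ∧ b' = b then 1 else 0 := by
  unfold Tcoeff
  rcases lt_trichotomy a b with hab | rfl | hab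
  · simp [hab, hab.not_gt, hab.not_ge]
  · simp
  · by_cases h₁ : a' = a ∧ b' = b
    · obtain ⟨rfl, rfl⟩ := h₁
      simp [hab, hab.ne']
    · simp [hab, hab.le, hab.not_gt, h₁]

lemma Tmat_apply {n p : ℕ} (h : p + 1 < 2 * n) (κ κ' : Lab n) :
    Tmat n p κ κ' =
      exchange tt (⟨p, by omega⟩ : Fin (2 * n)) ⟨p + 1, h⟩ (fun μ => if κ = μ then 1 else 0) κ' := by
  have hext (μ : Lab n) : κ = μ ↔
      (∀ j : Fin (2 * n), (j : ℕ) ≠ p → (j : ℕ) ≠ p + 1 → κ j = μ j) ∧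
      κ ⟨p, by omega⟩ = μ ⟨p, by omega⟩ ∧ κ ⟨p + 1, h⟩ = μ ⟨p + 1, h⟩ := by
    refine ⟨by rintro rfl; simp, fun ⟨h₁, h₂, h₃⟩ => funext fun j => ?_⟩
    by_cases hj : (j : ℕ) = p
    · rwa [show j = ⟨p, by omega⟩ from Fin.ext hj]
    by_cases hj' : (j : ℕ) = p + 1
    · rwa [show j = ⟨p + 1, h⟩ from Fin.ext hj']
    exact h₁ j hj hj'
  have hsw : κ = κ' ∘ Equiv.swap (⟨p, by omega⟩ : Fin (2 * n)) ⟨p + 1, h⟩ ↔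
      (∀ j : Fin (2 * n), (j : ℕ) ≠ p → (j : ℕ) ≠ p + 1 → κ j = κ' j) ∧
      κ ⟨p, by omega⟩ = κ' ⟨p + 1, h⟩ ∧ κ ⟨p + 1, h⟩ = κ' ⟨p, by omega⟩ := by
    rw [hext]
    simp only [Function.comp_apply, Equiv.swap_apply_left, Equiv.swap_apply_right]
    refine and_congr_left' (forall_congr' fun j => forall₂_congr fun h₁ h₂ => ?_)
    rw [Equiv.swap_apply_of_ne_of_ne] <;> simpa [Fin.ext_iff]
  rw [Tmat, Matrix.of_apply, dif_pos h, Tcoeff_eq]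
  simp only [exchange, hext κ', hsw]
  by_cases hP : ∀ j : Fin (2 * n), (j : ℕ) ≠ p → (j : ℕ) ≠ p + 1 → κ j = κ' j
  · simp only [if_pos hP, and_iff_right hP]
  · simp [hP]

lemma vecMul_Tmat {n p : ℕ} (h : p + 1 < 2 * n) (f : Lab n → F) :
    Matrix.vecMul f (Tmat n p) = exchange tt (⟨p, by omega⟩ : Fin (2 * n)) ⟨p + 1, h⟩ f := by
  funext κ'
  simp only [Matrix.vecMul, dotProduct, Tmat_apply h, exchange]
  split_ifs <;> simp [mul_add, Finset.sum_add_distrib, mul_comm]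

lemma Tmat_eq_zero {n p : ℕ} (h : ¬ p + 1 < 2 * n) : Tmat n p = 0 := by
  ext κ κ'
  simp [Tmat, h]

lemma Tmat_mul_self {n p : ℕ} (h : p + 1 < 2 * n) :
    Tmat n p * Tmat n p = (tt - 1) • Tmat n p + tt • 1 := by
  refine Matrix.ext_of_single_vecMul fun κ => ?_
  simp only [← Matrix.vecMul_vecMul, Matrix.vecMul_add, Matrix.vecMul_smul, vecMul_Tmat h,
    exchange_exchange_self, Matrix.vecMul_one]

lemma Tmat_braid {n p : ℕ} (h : p + 2 < 2 * n) :
    Tmat n p * Tmat n (p + 1) * Tmat n p = Tmat n (p + 1) * Tmat n p * Tmat n (p + 1) := by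
  refine Matrix.ext_of_single_vecMul fun κ => ?_
  simp only [← Matrix.vecMul_vecMul, vecMul_Tmat (show p + 1 < 2 * n by omega),
    vecMul_Tmat (show p + 1 + 1 < 2 * n by omega)]
  exact exchange_braid tt (by simp) (by simp; omega) (by simp) _

lemma commute_Tmat (n : ℕ) {p q : ℕ} (hpq : p + 2 ≤ q) : Commute (Tmat n p) (Tmat n q) := by
  by_cases h : q + 1 < 2 * n
  · refine Matrix.ext_of_single_vecMul fun κ => ?_
    simp only [← Matrix.vecMul_vecMul, vecMul_Tmat (show p + 1 < 2 * n by omega), vecMul_Tmat h]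
    apply exchange_comm <;> simp <;> omega
  · simp [Tmat_eq_zero h]

lemma commute_Rmat (n : ℕ) {p q : ℕ} (hpq : p + 2 ≤ q) (u v : F) :
    Commute (Rmat n p u) (Rmat n q v) := by
  refine Commute.add_left (((Commute.one_left _).smul_left _)) (Commute.smul_left ?_ _)
  exact Commute.add_right ((Commute.one_right _).smul_right _)
    ((commute_Tmat n hpq).smul_right _)

lemma yang_baxter_of_braid {R A : Type*} [CommRing R] [Ring A] [Algebra R A] {t : R} {a b : A}
    (ha : a * a = (t - 1) • a + t • (1 : A)) (hb : b * b = (t - 1) • b + t • (1 : A))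
    (hab : a * b * a = b * a * b) (u v : R) :
    ((1 - t) • (1 : A) + (1 - u) • a) * ((1 - t) • (1 : A) + (1 - u * v) • b) *
        ((1 - t) • (1 : A) + (1 - v) • a) =
      ((1 - t) • (1 : A) + (1 - v) • b) * ((1 - t) • (1 : A) + (1 - u * v) • a) *
        ((1 - t) • (1 : A) + (1 - u) • b) := by
  simp only [add_mul, mul_add, smul_mul_assoc, mul_smul_comm, one_mul, mul_one, ha, hb, hab]
  module

lemma yang_baxter {n p : ℕ} (h : p + 2 < 2 * n) {u v w : F} (hw : w = u * v) :
    Rmat n p u * Rmat n (p + 1) w * Rmat n p v =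
      Rmat n (p + 1) v * Rmat n p w * Rmat n (p + 1) u := by
  subst hw
  exact yang_baxter_of_braid (Tmat_mul_self (by omega)) (Tmat_mul_self (by omega))
    (Tmat_braid h) u v

/-- The product `Ř_{p+m-1}(x_{m-1}/y) ⋯ Ř_p(x_0/y)`. -/
def column (n p m : ℕ) (x : ℕ → F) (y : F) : Mat n :=
  ((List.range m).map fun r => Rmat n (p + (m - 1 - r)) (x (m - 1 - r) / y)).prod

lemma column_zero (n p : ℕ) (x : ℕ → F) (y : F) : column n p 0 x y = 1 := rfl

lemma column_succ (n p m : ℕ) (x : ℕ → F) (y : F) :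
    column n p (m + 1) x y = Rmat n (p + m) (x m / y) * column n p m x y := by
  simp only [column, List.range_succ_eq_map, List.map_cons, List.prod_cons, List.map_map]
  refine congrArg₂ _ (by simp) (congrArg _ (List.map_congr_left fun r _ => ?_))
  simp [show m - (r + 1) = m - 1 - r by omega]

lemma column_congr (n p : ℕ) {m : ℕ} {x x' : ℕ → F} (h : ∀ r < m, x r = x' r) (y : F) :
    column n p m x y = column n p m x' y := by
  induction m with
  | zero => rfl
  | succ m ih =>
    rw [column_succ, column_succ, ih fun r hr => h r (by omega), h m (by omega)]

lemma commute_Rmat_column (n : ℕ) {p m q : ℕ} (h : p + m < q) (u : F) (x : ℕ → F) (y : F) :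
    Commute (Rmat n q u) (column n p m x y) := by
  induction m with
  | zero => exact Commute.one_right _
  | succ m ih =>
    rw [column_succ]
    exact (commute_Rmat n (by omega) _ _).symm.mul_right (ih (by omega))

lemma commute_column_Rmat (n : ℕ) {p q : ℕ} (h : q + 2 ≤ p) (m : ℕ) (u : F) (x : ℕ → F) (y : F) :
    Commute (Rmat n q u) (column n p m x y) := by
  induction m with
  | zero => exact Commute.one_right _
  | succ m ih =>
    rw [column_succ]
    exact (commute_Rmat n (by omega) _ _).mul_right ih

lemma column_swap_mul_Rmat {n p m i : ℕ} (hi : i + 1 < m) (hp : p + i + 2 < 2 * n)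
    {x x' : ℕ → F} (h₁ : x' i = x (i + 1)) (h₂ : x' (i + 1) = x i)
    (h₃ : ∀ k, k ≠ i → k ≠ i + 1 → x' k = x k) (hx : x i ≠ 0) (y : F) :
    column n p m x' y * Rmat n (p + i + 1) (x (i + 1) / x i) =
      Rmat n (p + i) (x (i + 1) / x i) * column n p m x y := by
  induction m, hi using Nat.le_induction with
  | base =>
    have hyb := yang_baxter hp (u := x (i + 1) / x i) (v := x i / y) (w := x (i + 1) / y)
      (by field_simp)
    have hc := (commute_Rmat_column n (show p + i < p + i + 1 by omega)
      (x (i + 1) / x i) x y).eq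
    rw [column_succ, column_succ, column_succ, column_succ, h₁, h₂,
      column_congr n p (fun r hr => h₃ r (by omega) (by omega)) y, mul_assoc, mul_assoc, ← hc,
      ← add_assoc p i 1]
    simp only [← mul_assoc]
    rw [hyb]
  | succ m hm ih =>
    rw [column_succ, column_succ, h₃ m (by omega) (by omega), mul_assoc, ih, ← mul_assoc,
      ← mul_assoc, (commute_Rmat n (show p + i + 2 ≤ p + m by omega) _ _).eq]

lemma Rmat_mul_column_mul_column {n p m : ℕ} (h : p + m + 1 < 2 * n) (x : ℕ → F) {y y' : F}
    (hy : y ≠ 0) :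
    Rmat n (p + m) (y / y') * (column n p m x y' * column n (p + 1) m x y) =
      column n p m x y * column n (p + 1) m x y' * Rmat n p (y / y') := by
  induction m with
  | zero => simp [column_zero]
  | succ m ih =>
    have hyb := yang_baxter (show p + m + 2 < 2 * n by omega) (u := x m / y) (v := y / y')
      (w := x m / y') (by field_simp)
    have hc (a b : F) := (commute_Rmat_column n (show p + m < p + m + 1 by omega) a x b).eq
    simp only [column_succ, show p + 1 + m = p + m + 1 by omega, ← add_assoc]
    calc _ = Rmat n (p + m + 1) (y / y') * Rmat n (p + m) (x m / y') *
            (column n p m x y' * Rmat n (p + m + 1) (x m / y)) * column n (p + 1) m x y := by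
          simp only [mul_assoc]
      _ = Rmat n (p + m + 1) (y / y') * Rmat n (p + m) (x m / y') * Rmat n (p + m + 1) (x m / y) *
            (column n p m x y' * column n (p + 1) m x y) := by
          rw [← hc]; simp only [mul_assoc]
      _ = Rmat n (p + m) (x m / y) * Rmat n (p + m + 1) (x m / y') *
            (column n p m x y * column n (p + 1) m x y' * Rmat n p (y / y')) := by
          rw [← hyb, ← ih (by omega)]; simp only [mul_assoc]
      _ = Rmat n (p + m) (x m / y) * (Rmat n (p + m + 1) (x m / y') * column n p m x y) *
            (column n (p + 1) m x y' * Rmat n p (y / y')) := by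
          simp only [mul_assoc]
      _ = _ := by
          rw [hc]; simp only [mul_assoc]

/-- The product of the first `m` columns of `Zmat n x y`. -/
def columns (n m : ℕ) (x y : ℕ → F) : Mat n :=
  ((List.range m).map fun j => column n j n x (y j)).prod

lemma columns_succ (n m : ℕ) (x y : ℕ → F) :
    columns n (m + 1) x y = columns n m x y * column n m n x (y m) := by
  simp [columns, List.range_succ]

lemma columns_congr (n : ℕ) {m : ℕ} (x : ℕ → F) {y y' : ℕ → F} (h : ∀ r < m, y r = y' r) :
    columns n m x y = columns n m x y' := by
  induction m with
  | zero => rfl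
  | succ m ih =>
    rw [columns_succ, columns_succ, ih fun r hr => h r (by omega), h m (by omega)]

lemma commute_Rmat_columns (n : ℕ) {m q : ℕ} (h : n + m ≤ q) (u : F) (x y : ℕ → F) :
    Commute (Rmat n q u) (columns n m x y) := by
  induction m with
  | zero => exact Commute.one_right _
  | succ m ih =>
    rw [columns_succ]
    exact (ih (by omega)).mul_right (commute_Rmat_column n (by omega) _ _ _)

lemma columns_swap_left {n m i : ℕ} (hi : i + 1 < n) (hm : m ≤ n)
    {x x' : ℕ → F} (h₁ : x' i = x (i + 1)) (h₂ : x' (i + 1) = x i)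
    (h₃ : ∀ k, k ≠ i → k ≠ i + 1 → x' k = x k) (hx : x i ≠ 0) (y : ℕ → F) :
    columns n m x' y * Rmat n (m + i) (x (i + 1) / x i) =
      Rmat n i (x (i + 1) / x i) * columns n m x y := by
  induction m with
  | zero => simp [columns]
  | succ m ih =>
    rw [columns_succ, columns_succ, mul_assoc, show m + 1 + i = m + i + 1 by omega,
      column_swap_mul_Rmat hi (by omega) h₁ h₂ h₃ hx, ← mul_assoc, ih (by omega), mul_assoc]

lemma columns_swap_right {n m j : ℕ} (hj : j + 1 < m) (hm : m ≤ n) (x : ℕ → F)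
    {y y' : ℕ → F} (h₁ : y' j = y (j + 1)) (h₂ : y' (j + 1) = y j)
    (h₃ : ∀ k, k ≠ j → k ≠ j + 1 → y' k = y k) (hy : y j ≠ 0) :
    Rmat n (n + j) (y j / y (j + 1)) * columns n m x y' =
      columns n m x y * Rmat n j (y j / y (j + 1)) := by
  induction m, hj using Nat.le_induction with
  | base =>
    have hc := (commute_Rmat_columns n le_rfl (y j / y (j + 1)) x y (m := j)).eq
    have hcol := Rmat_mul_column_mul_column (show j + n + 1 < 2 * n by omega) x (y' := y (j + 1)) hy
    simp only [Nat.succ_eq_add_one]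
    rw [columns_succ, columns_succ, columns_succ, columns_succ, h₁, h₂,
      columns_congr n x fun r hr => h₃ r (by omega) (by omega), mul_assoc (columns n j x y),
      ← mul_assoc, hc, mul_assoc, add_comm n j, hcol]
    simp only [mul_assoc]
  | succ m hm' ih =>
    rw [columns_succ, columns_succ, h₃ m (by omega) (by omega), ← mul_assoc, ih (by omega),
      mul_assoc, mul_assoc, (commute_column_Rmat n (by omega) n _ x (y m)).eq]

lemma Zmat_eq_columns (n : ℕ) (x y : ℕ → F) : Zmat n x y = columns n n x y := rfl

/-- the exchange relations for `Z`:
`(τ_i Z)·Ř_{n+i}(x_{i+1}/x_i) = Ř_i(x_{i+1}/x_i)·Z` and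
`Ř_{n+j}(y_j/y_{j+1})·(τ'_j Z) = Z·Ř_j(y_j/y_{j+1})` (0-based positions). -/
theorem statement12 (n : ℕ) (hn : 1 ≤ n) :
    (∀ i : ℕ, i + 1 < n →
        Zmat n (fun k => if k = i then xx (i + 1) else if k = i + 1 then xx i else xx k) yy *
            Rmat n (n + i) (xx (i + 1) / xx i) =
          Rmat n i (xx (i + 1) / xx i) * Zmat n xx yy) ∧
      ∀ j : ℕ, j + 1 < n →
        Rmat n (n + j) (yy j / yy (j + 1)) *
            Zmat n xx (fun k => if k = j then yy (j + 1) else if k = j + 1 then yy j else yy k) =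
          Zmat n xx yy * Rmat n j (yy j / yy (j + 1)) := by
  simp only [Zmat_eq_columns]
  refine ⟨fun i hi => columns_swap_left hi le_rfl ?_ ?_ ?_ (xx_ne_zero i) yy,
    fun j hj => columns_swap_right hj le_rfl xx ?_ ?_ ?_ (yy_ne_zero j)⟩
  · rw [if_pos rfl]
  · rw [if_neg (by omega), if_pos rfl]
  · intro k h₁ h₂
    rw [if_neg h₁, if_neg h₂]
  · rw [if_pos rfl]
  · rw [if_neg (by omega), if_pos rfl]
  · intro k h₁ h₂
    rw [if_neg h₁, if_neg h₂]
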